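/- Let n ≥ 1, let α_1,…,α_n be programs containing no variables, and let φ_1,…,φ_n, ψ_1,…,ψ_n be variable-free formulas. Let φ(x) = [α_1](φ_1 ∨ (ψ_1 ∧ [α_2](φ_2 ∨ (ψ_2 ∧ … [α_n](φ_n ∨ (ψ_n ∧ x)) … )))). Then λ_2 := [(⨀_{i=1}^n α_i;¬̄φ_i?)*] ⋀_{j=1}^n [⨀_{k=1}^j α_k;¬̄φ_k?] ψ_j is a solution to the fixed-point equation x ≡ φ(x); that is, λ_2 contains no occurrence of x and λ_2 ≡ φ(λ_2) is valid. -/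

import Mathlib

mutual
inductive PDLFormula (P V A : Type) : Type
  | var : V → PDLFormula P V A
  | atom : P → PDLFormula P V A
  | natom : P → PDLFormula P V A
  | or : PDLFormula P V A → PDLFormula P V A → PDLFormula P V A
  | and : PDLFormula P V A → PDLFormula P V A → PDLFormula P V A
  | dia : PDLProgram P V A → PDLFormula P V A → PDLFormula P V A
  | box : PDLProgram P V A → PDLFormula P V A → PDLFormula P V A

inductive PDLProgram (P V A : Type) : Type
  | aprog : A → PDLProgram P V A
  | test : PDLFormula P V A → PDLProgram P V A
  | seq : PDLProgram P V A → PDLProgram P V A → PDLProgram P V A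
  | union : PDLProgram P V A → PDLProgram P V A → PDLProgram P V A
  | star : PDLProgram P V A → PDLProgram P V A
end

structure PDLModel (P V A : Type) where
  W : Type
  nonempty : Nonempty W
  R : A → W → W → Prop
  Vp : P → Set W
  Vv : V → Set W

mutual
def PDLModel.Sat {P V A : Type} (M : PDLModel P V A) : PDLFormula P V A → M.W → Prop
  | .var x => fun w => w ∈ M.Vv x
  | .atom p => fun w => w ∈ M.Vp p
  | .natom p => fun w => w ∉ M.Vp p
  | .or φ ψ => fun w => M.Sat φ w ∨ M.Sat ψ w
  | .and φ ψ => fun w => M.Sat φ w ∧ M.Sat ψ w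
  | .dia α φ => fun w => ∃ u, M.Rel α w u ∧ M.Sat φ u
  | .box α φ => fun w => ∀ u, M.Rel α w u → M.Sat φ u

def PDLModel.Rel {P V A : Type} (M : PDLModel P V A) : PDLProgram P V A → M.W → M.W → Prop
  | .aprog a => M.R a
  | .test φ => fun w u => w = u ∧ M.Sat φ w
  | .seq α β => fun w u => ∃ v, M.Rel α w v ∧ M.Rel β v u
  | .union α β => fun w u => M.Rel α w u ∨ M.Rel β w u
  | .star α => Relation.ReflTransGen (M.Rel α)
end

def PDLFormula.nneg {P V A : Type} : PDLFormula P V A → PDLFormula P V A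
  | .var x => .var x
  | .atom p => .natom p
  | .natom p => .atom p
  | .or φ ψ => .and φ.nneg ψ.nneg
  | .and φ ψ => .or φ.nneg ψ.nneg
  | .dia α φ => .box α φ.nneg
  | .box α φ => .dia α φ.nneg

mutual
def PDLFormula.noVar {P V A : Type} : PDLFormula P V A → Prop
  | .var _ => False
  | .atom _ => True
  | .natom _ => True
  | .or φ ψ => φ.noVar ∧ ψ.noVar
  | .and φ ψ => φ.noVar ∧ ψ.noVar
  | .dia α φ => α.noVar ∧ φ.noVar
  | .box α φ => α.noVar ∧ φ.noVar

def PDLProgram.noVar {P V A : Type} : PDLProgram P V A → Prop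
  | .aprog _ => True
  | .test φ => φ.noVar
  | .seq α β => α.noVar ∧ β.noVar
  | .union α β => α.noVar ∧ β.noVar
  | .star α => α.noVar
end

mutual
def PDLFormula.xFree {P V A : Type} (x : V) : PDLFormula P V A → Prop
  | .var y => y ≠ x
  | .atom _ => True
  | .natom _ => True
  | .or φ ψ => φ.xFree x ∧ ψ.xFree x
  | .and φ ψ => φ.xFree x ∧ ψ.xFree x
  | .dia α φ => α.xFree x ∧ φ.xFree x
  | .box α φ => α.xFree x ∧ φ.xFree x

def PDLProgram.xFree {P V A : Type} (x : V) : PDLProgram P V A → Prop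
  | .aprog _ => True
  | .test φ => φ.xFree x
  | .seq α β => α.xFree x ∧ β.xFree x
  | .union α β => α.xFree x ∧ β.xFree x
  | .star α => α.xFree x
end

mutual
def PDLFormula.subst {P V A : Type} [DecidableEq V] (x : V) (ψ : PDLFormula P V A) :
    PDLFormula P V A → PDLFormula P V A
  | .var y => if y = x then ψ else .var y
  | .atom p => .atom p
  | .natom p => .natom p
  | .or φ χ => .or (PDLFormula.subst x ψ φ) (PDLFormula.subst x ψ χ)
  | .and φ χ => .and (PDLFormula.subst x ψ φ) (PDLFormula.subst x ψ χ)
  | .dia α φ => .dia (PDLProgram.subst x ψ α) (PDLFormula.subst x ψ φ)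
  | .box α φ => .box (PDLProgram.subst x ψ α) (PDLFormula.subst x ψ φ)

def PDLProgram.subst {P V A : Type} [DecidableEq V] (x : V) (ψ : PDLFormula P V A) :
    PDLProgram P V A → PDLProgram P V A
  | .aprog a => .aprog a
  | .test φ => .test (PDLFormula.subst x ψ φ)
  | .seq α β => .seq (PDLProgram.subst x ψ α) (PDLProgram.subst x ψ β)
  | .union α β => .union (PDLProgram.subst x ψ α) (PDLProgram.subst x ψ β)
  | .star α => .star (PDLProgram.subst x ψ α)
end

/-- Nested box form: `[α_i](φ_i ∨ (ψ_i ∧ [α_{i+1}](…)))` with `m` levels starting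
at index `i`, and the variable `x` innermost. -/
def nestBoxOr {P V A : Type} (αs : ℕ → PDLProgram P V A) (φs ψs : ℕ → PDLFormula P V A)
    (x : V) : ℕ → ℕ → PDLFormula P V A
  | 0, _ => .var x
  | m + 1, i => .box (αs i) (.or (φs i) (.and (ψs i) (nestBoxOr αs φs ψs x m (i + 1))))

/-- Nested diamond form: `⟨α_i⟩(φ_i ∧ (ψ_i ∨ ⟨α_{i+1}⟩(…)))` with `m` levels starting
at index `i`, and the variable `x` innermost. -/
def nestDiaAnd {P V A : Type} (αs : ℕ → PDLProgram P V A) (φs ψs : ℕ → PDLFormula P V A)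
    (x : V) : ℕ → ℕ → PDLFormula P V A
  | 0, _ => .var x
  | m + 1, i => .dia (αs i) (.and (φs i) (.or (ψs i) (nestDiaAnd αs φs ψs x m (i + 1))))

/-- `seqPrefFrom base step j = base ; step 2 ; step 3 ; … ; step j` (left associated);
for `j ≤ 1` it is just `base`. -/
def seqPrefFrom {P V A : Type} (base : PDLProgram P V A) (step : ℕ → PDLProgram P V A) :
    ℕ → PDLProgram P V A
  | 0 => base
  | 1 => base
  | j + 2 => .seq (seqPrefFrom base step (j + 1)) (step (j + 2))

/-- `bigAndUp χ n = χ 1 ∧ χ 2 ∧ … ∧ χ n` (left associated); `bigAndUp χ 1 = χ 1`. -/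
def bigAndUp {P V A : Type} (χ : ℕ → PDLFormula P V A) : ℕ → PDLFormula P V A
  | 0 => χ 0
  | 1 => χ 1
  | j + 2 => .and (bigAndUp χ (j + 1)) (χ (j + 2))

/-- `bigOrUp χ n = χ 1 ∨ χ 2 ∨ … ∨ χ n` (left associated); `bigOrUp χ 1 = χ 1`. -/
def bigOrUp {P V A : Type} (χ : ℕ → PDLFormula P V A) : ℕ → PDLFormula P V A
  | 0 => χ 0
  | 1 => χ 1
  | j + 2 => .or (bigOrUp χ (j + 1)) (χ (j + 2))

mutual
theorem PDLFormula.noVar.xFree {P V A : Type} (x : V) :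
    ∀ φ : PDLFormula P V A, φ.noVar → φ.xFree x
  | .var _, h => by simp [PDLFormula.noVar] at h
  | .atom _, _ => by simp [PDLFormula.xFree]
  | .natom _, _ => by simp [PDLFormula.xFree]
  | .or φ ψ, h => by
      simp only [PDLFormula.noVar, PDLFormula.xFree] at h ⊢
      exact ⟨PDLFormula.noVar.xFree x φ h.1, PDLFormula.noVar.xFree x ψ h.2⟩
  | .and φ ψ, h => by
      simp only [PDLFormula.noVar, PDLFormula.xFree] at h ⊢
      exact ⟨PDLFormula.noVar.xFree x φ h.1, PDLFormula.noVar.xFree x ψ h.2⟩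
  | .dia α φ, h => by
      simp only [PDLFormula.noVar, PDLFormula.xFree] at h ⊢
      exact ⟨PDLProgram.noVar.xFree x α h.1, PDLFormula.noVar.xFree x φ h.2⟩
  | .box α φ, h => by
      simp only [PDLFormula.noVar, PDLFormula.xFree] at h ⊢
      exact ⟨PDLProgram.noVar.xFree x α h.1, PDLFormula.noVar.xFree x φ h.2⟩

theorem PDLProgram.noVar.xFree {P V A : Type} (x : V) :
    ∀ α : PDLProgram P V A, α.noVar → α.xFree x
  | .aprog _, _ => by simp [PDLProgram.xFree]
  | .test φ, h => by
      simp only [PDLProgram.noVar, PDLProgram.xFree] at h ⊢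
      exact PDLFormula.noVar.xFree x φ h
  | .seq α β, h => by
      simp only [PDLProgram.noVar, PDLProgram.xFree] at h ⊢
      exact ⟨PDLProgram.noVar.xFree x α h.1, PDLProgram.noVar.xFree x β h.2⟩
  | .union α β, h => by
      simp only [PDLProgram.noVar, PDLProgram.xFree] at h ⊢
      exact ⟨PDLProgram.noVar.xFree x α h.1, PDLProgram.noVar.xFree x β h.2⟩
  | .star α, h => by
      simp only [PDLProgram.noVar, PDLProgram.xFree] at h ⊢
      exact PDLProgram.noVar.xFree x α h
end

mutual
theorem PDLFormula.xFree.subst_eq {P V A : Type} [DecidableEq V] (x : V) (χ : PDLFormula P V A) :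
    ∀ φ : PDLFormula P V A, φ.xFree x → PDLFormula.subst x χ φ = φ
  | .var y, h => by
      simp only [PDLFormula.xFree] at h
      simp [PDLFormula.subst, h]
  | .atom _, _ => by simp [PDLFormula.subst]
  | .natom _, _ => by simp [PDLFormula.subst]
  | .or φ ψ, h => by
      simp only [PDLFormula.xFree] at h
      rw [PDLFormula.subst, PDLFormula.xFree.subst_eq x χ φ h.1,
        PDLFormula.xFree.subst_eq x χ ψ h.2]
  | .and φ ψ, h => by
      simp only [PDLFormula.xFree] at h
      rw [PDLFormula.subst, PDLFormula.xFree.subst_eq x χ φ h.1,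
        PDLFormula.xFree.subst_eq x χ ψ h.2]
  | .dia α φ, h => by
      simp only [PDLFormula.xFree] at h
      rw [PDLFormula.subst, PDLProgram.xFree.subst_eq x χ α h.1,
        PDLFormula.xFree.subst_eq x χ φ h.2]
  | .box α φ, h => by
      simp only [PDLFormula.xFree] at h
      rw [PDLFormula.subst, PDLProgram.xFree.subst_eq x χ α h.1,
        PDLFormula.xFree.subst_eq x χ φ h.2]

theorem PDLProgram.xFree.subst_eq {P V A : Type} [DecidableEq V] (x : V) (χ : PDLFormula P V A) :
    ∀ α : PDLProgram P V A, α.xFree x → PDLProgram.subst x χ α = α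
  | .aprog _, _ => by simp [PDLProgram.subst]
  | .test φ, h => by
      simp only [PDLProgram.xFree] at h
      rw [PDLProgram.subst, PDLFormula.xFree.subst_eq x χ φ h]
  | .seq α β, h => by
      simp only [PDLProgram.xFree] at h
      rw [PDLProgram.subst, PDLProgram.xFree.subst_eq x χ α h.1,
        PDLProgram.xFree.subst_eq x χ β h.2]
  | .union α β, h => by
      simp only [PDLProgram.xFree] at h
      rw [PDLProgram.subst, PDLProgram.xFree.subst_eq x χ α h.1,
        PDLProgram.xFree.subst_eq x χ β h.2]
  | .star α, h => by
      simp only [PDLProgram.xFree] at h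
      rw [PDLProgram.subst, PDLProgram.xFree.subst_eq x χ α h]
end

theorem PDLFormula.noVar.nneg {P V A : Type} :
    ∀ φ : PDLFormula P V A, φ.noVar → φ.nneg.noVar
  | .var _, h => by simp [PDLFormula.noVar] at h
  | .atom _, _ => by simp [PDLFormula.nneg, PDLFormula.noVar]
  | .natom _, _ => by simp [PDLFormula.nneg, PDLFormula.noVar]
  | .or φ ψ, h => by
      simp only [PDLFormula.noVar, PDLFormula.nneg] at h ⊢
      exact ⟨PDLFormula.noVar.nneg φ h.1, PDLFormula.noVar.nneg ψ h.2⟩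
  | .and φ ψ, h => by
      simp only [PDLFormula.noVar, PDLFormula.nneg] at h ⊢
      exact ⟨PDLFormula.noVar.nneg φ h.1, PDLFormula.noVar.nneg ψ h.2⟩
  | .dia α φ, h => by
      simp only [PDLFormula.noVar, PDLFormula.nneg] at h ⊢
      exact ⟨h.1, PDLFormula.noVar.nneg φ h.2⟩
  | .box α φ, h => by
      simp only [PDLFormula.noVar, PDLFormula.nneg] at h ⊢
      exact ⟨h.1, PDLFormula.noVar.nneg φ h.2⟩

theorem PDLModel.sat_nneg {P V A : Type} (M : PDLModel P V A) :
    ∀ φ : PDLFormula P V A, φ.noVar → ∀ w, M.Sat φ.nneg w ↔ ¬ M.Sat φ w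
  | .var _, h, _ => by simp [PDLFormula.noVar] at h
  | .atom _, _, _ => by simp [PDLFormula.nneg, PDLModel.Sat]
  | .natom _, _, _ => by simp [PDLFormula.nneg, PDLModel.Sat]
  | .or φ ψ, h, w => by
      simp only [PDLFormula.noVar] at h
      simp only [PDLFormula.nneg, PDLModel.Sat, PDLModel.sat_nneg M φ h.1,
        PDLModel.sat_nneg M ψ h.2, not_or]
  | .and φ ψ, h, w => by
      simp only [PDLFormula.noVar] at h
      simp only [PDLFormula.nneg, PDLModel.Sat, PDLModel.sat_nneg M φ h.1,
        PDLModel.sat_nneg M ψ h.2, not_and_or]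
  | .dia α φ, h, w => by
      simp only [PDLFormula.noVar] at h
      simp only [PDLFormula.nneg, PDLModel.Sat, PDLModel.sat_nneg M φ h.2, not_exists, not_and]
  | .box α φ, h, w => by
      simp only [PDLFormula.noVar] at h
      simp only [PDLFormula.nneg, PDLModel.Sat, PDLModel.sat_nneg M φ h.2, not_forall,
        exists_prop]

theorem xFree_seqPrefFrom {P V A : Type} (x : V) (step : ℕ → PDLProgram P V A) (n : ℕ)
    (h : ∀ i, 1 ≤ i → i ≤ n → (step i).xFree x) :
    ∀ j, 1 ≤ j → j ≤ n → (seqPrefFrom (step 1) step j).xFree x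
  | 1, hj, hn => h 1 hj hn
  | j + 2, _, hn => by
      simp only [seqPrefFrom, PDLProgram.xFree]
      exact ⟨xFree_seqPrefFrom x step n h (j + 1) (by omega) (by omega),
        h (j + 2) (by omega) hn⟩

theorem xFree_bigAndUp {P V A : Type} (x : V) (χ : ℕ → PDLFormula P V A) :
    ∀ n, 1 ≤ n → (∀ j, 1 ≤ j → j ≤ n → (χ j).xFree x) → (bigAndUp χ n).xFree x
  | 1, _, h => h 1 le_rfl le_rfl
  | n + 2, _, h => by
      simp only [bigAndUp, PDLFormula.xFree]
      exact ⟨xFree_bigAndUp x χ (n + 1) (by omega) fun j h₁ h₂ => h j h₁ (by omega),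
        h (n + 2) (by omega) le_rfl⟩

theorem PDLModel.sat_bigAndUp {P V A : Type} (M : PDLModel P V A) (χ : ℕ → PDLFormula P V A)
    (w : M.W) : ∀ n, 1 ≤ n →
      (M.Sat (bigAndUp χ n) w ↔ ∀ j, 0 < j → j ≤ n → M.Sat (χ j) w)
  | 1, _ => ⟨fun h j h₁ h₂ => by
      obtain rfl : j = 1 := by omega
      exact h, fun h => h 1 one_pos le_rfl⟩
  | n + 2, _ => by
      simp only [bigAndUp, PDLModel.Sat, PDLModel.sat_bigAndUp M χ w (n + 1) (by omega)]
      constructor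
      · rintro ⟨h, h'⟩ j h₁ h₂
        rcases Nat.lt_or_ge j (n + 2) with hj | hj
        · exact h j h₁ (by omega)
        · obtain rfl : j = n + 2 := by omega
          exact h'
      · exact fun h => ⟨fun j h₁ h₂ => h j h₁ (by omega), h (n + 2) (by omega) le_rfl⟩

/-- The composition of the relations of `step 1, …, step j`, the identity for `j = 0`. -/
def PDLModel.stepRel {P V A : Type} (M : PDLModel P V A) (step : ℕ → PDLProgram P V A) :
    ℕ → M.W → M.W → Prop
  | 0 => Eq
  | j + 1 => fun w u => ∃ v, M.stepRel step j w v ∧ M.Rel (step (j + 1)) v u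

theorem PDLModel.rel_seqPrefFrom {P V A : Type} (M : PDLModel P V A)
    (step : ℕ → PDLProgram P V A) (w : M.W) : ∀ j, 1 ≤ j → ∀ u : M.W,
      (M.Rel (seqPrefFrom (step 1) step j) w u ↔ M.stepRel step j w u)
  | 1, _, u => by simp [seqPrefFrom, PDLModel.stepRel]
  | j + 2, _, u => by
      rw [seqPrefFrom, PDLModel.Rel, PDLModel.stepRel]
      simp only [PDLModel.rel_seqPrefFrom M step w (j + 1) (by omega)]

theorem PDLModel.sat_subst_nestBoxOr {P V A : Type} [DecidableEq V] (M : PDLModel P V A)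
    (x : V) (χ : PDLFormula P V A) (n : ℕ)
    (αs : ℕ → PDLProgram P V A) (φs ψs : ℕ → PDLFormula P V A)
    (hα : ∀ i, 1 ≤ i → i ≤ n → (αs i).xFree x)
    (hφ : ∀ i, 1 ≤ i → i ≤ n → (φs i).noVar)
    (hψ : ∀ i, 1 ≤ i → i ≤ n → (ψs i).xFree x) (w : M.W) :
    ∀ m k, k + m = n →
      ((∀ u, M.stepRel (fun i => .seq (αs i) (.test (φs i).nneg)) k w u →
          M.Sat (PDLFormula.subst x χ (nestBoxOr αs φs ψs x m (k + 1))) u) ↔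
        (∀ j, k < j → j ≤ n →
          ∀ u, M.stepRel (fun i => .seq (αs i) (.test (φs i).nneg)) j w u → M.Sat (ψs j) u) ∧
        ∀ u, M.stepRel (fun i => .seq (αs i) (.test (φs i).nneg)) n w u → M.Sat χ u)
  | 0, k, hk => by
      obtain rfl : k = n := hk
      simp only [nestBoxOr, PDLFormula.subst, if_true]
      exact ⟨fun h => ⟨fun j h₁ h₂ => absurd h₁ (by omega), h⟩, fun h => h.2⟩
  | m + 1, k, hk => by
      have ih := PDLModel.sat_subst_nestBoxOr M x χ n αs φs ψs hα hφ hψ w m (k + 1) (by omega)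
      have hk₁ : 1 ≤ k + 1 := by omega
      have hk₂ : k + 1 ≤ n := by omega
      have key : (∀ u, M.stepRel (fun i => .seq (αs i) (.test (φs i).nneg)) k w u →
            M.Sat (PDLFormula.subst x χ (nestBoxOr αs φs ψs x (m + 1) (k + 1))) u) ↔
          ∀ u, M.stepRel (fun i => .seq (αs i) (.test (φs i).nneg)) (k + 1) w u →
            M.Sat (ψs (k + 1)) u ∧
              M.Sat (PDLFormula.subst x χ (nestBoxOr αs φs ψs x m (k + 1 + 1))) u := by
        simp only [nestBoxOr, PDLFormula.subst, PDLModel.Sat, PDLModel.stepRel, PDLModel.Rel,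
          PDLProgram.xFree.subst_eq x χ _ (hα _ hk₁ hk₂),
          PDLFormula.xFree.subst_eq x χ _ (PDLFormula.noVar.xFree x _ (hφ _ hk₁ hk₂)),
          PDLFormula.xFree.subst_eq x χ _ (hψ _ hk₁ hk₂),
          PDLModel.sat_nneg M _ (hφ _ hk₁ hk₂)]
        constructor
        · rintro h u ⟨v, hv, u', hu, rfl, hn⟩
          exact (h v hv u' hu).resolve_left hn
        · intro h v hv u hu
          by_cases hn : M.Sat (φs (k + 1)) u
          · exact Or.inl hn
          · exact Or.inr (h u ⟨v, hv, u, hu, rfl, hn⟩)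
      rw [key]
      constructor
      · intro h
        obtain ⟨h₁, h₂⟩ := ih.1 fun u hu => (h u hu).2
        refine ⟨fun j hj hjn => ?_, h₂⟩
        rcases Nat.lt_or_ge (k + 1) j with hj' | hj'
        · exact h₁ j hj' hjn
        · obtain rfl : j = k + 1 := by omega
          exact fun u hu => (h u hu).1
      · rintro ⟨h₁, h₂⟩ u hu
        exact ⟨h₁ (k + 1) (by omega) hk₂ u hu,
          ih.2 ⟨fun j hj hjn => h₁ j (by omega) hjn, h₂⟩ u hu⟩

theorem PDLModel.sat_box_star_iff {P V A : Type} (M : PDLModel P V A) (α : PDLProgram P V A)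
    (φ : PDLFormula P V A) (w : M.W) :
    M.Sat (.box (.star α) φ) w ↔ M.Sat φ w ∧ ∀ u, M.Rel α w u → M.Sat (.box (.star α) φ) u := by
  simp only [PDLModel.Sat, PDLModel.Rel]
  constructor
  · exact fun h => ⟨h w .refl, fun u hu v hv => h v (.head hu hv)⟩
  · rintro ⟨h, h'⟩ u hu
    rcases hu.cases_head with rfl | ⟨v, hv, hvu⟩
    · exact h
    · exact h' v hv u hvu

/-- for `n ≥ 1`, variable-free programs `α_1,…,α_n` and variable-free
formulas `φ_1,…,φ_n,ψ_1,…,ψ_n`, the formula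
`λ₂ = [(⨀_{i=1}^n α_i;¬̄φ_i?)*] ⋀_{j=1}^n [⨀_{k=1}^j α_k;¬̄φ_k?] ψ_j`
is a solution of `x ≡ [α_1](φ_1 ∨ (ψ_1 ∧ [α_2](φ_2 ∨ (ψ_2 ∧ … [α_n](φ_n ∨ (ψ_n ∧ x))…))))`. -/
theorem lambda2_solves_odd_Pi_form {P V A : Type} [DecidableEq V]
    (x : V) (n : ℕ) (hn : 1 ≤ n)
    (αs : ℕ → PDLProgram P V A) (φs ψs : ℕ → PDLFormula P V A)
    (hα : ∀ i, 1 ≤ i → i ≤ n → (αs i).noVar)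
    (hφ : ∀ i, 1 ≤ i → i ≤ n → (φs i).noVar)
    (hψ : ∀ i, 1 ≤ i → i ≤ n → (ψs i).noVar) :
    let step : ℕ → PDLProgram P V A := fun i => .seq (αs i) (.test (φs i).nneg)
    let lam : PDLFormula P V A :=
      .box (.star (seqPrefFrom (step 1) step n))
        (bigAndUp (fun j => .box (seqPrefFrom (step 1) step j) (ψs j)) n)
    let φx : PDLFormula P V A := nestBoxOr αs φs ψs x n 1
    lam.xFree x ∧
      ∀ (M : PDLModel P V A) (w : M.W),
        M.Sat lam w ↔ M.Sat (PDLFormula.subst x lam φx) w := by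
  intro step lam φx
  have hα' := fun i h₁ h₂ => PDLProgram.noVar.xFree x _ (hα i h₁ h₂)
  have hψ' := fun i h₁ h₂ => PDLFormula.noVar.xFree x _ (hψ i h₁ h₂)
  have hstep : ∀ i, 1 ≤ i → i ≤ n → (step i).xFree x := by
    intro i h₁ h₂
    simp only [step, PDLProgram.xFree]
    exact ⟨hα' i h₁ h₂, PDLFormula.noVar.xFree x _ (PDLFormula.noVar.nneg _ (hφ i h₁ h₂))⟩
  have hpre := xFree_seqPrefFrom x step n hstep
  constructor
  · simp only [lam, PDLFormula.xFree, PDLProgram.xFree]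
    refine ⟨hpre n hn le_rfl, xFree_bigAndUp x _ n hn fun j h₁ h₂ => ?_⟩
    simp only [PDLFormula.xFree]
    exact ⟨hpre j h₁ h₂, hψ' j h₁ h₂⟩
  · intro M w
    have h := PDLModel.sat_subst_nestBoxOr M x lam n αs φs ψs hα' hφ hψ' w n 0 (by omega)
    simp only [PDLModel.stepRel, forall_eq'] at h
    refine Iff.trans ?_ h.symm
    refine (PDLModel.sat_box_star_iff M _ _ w).trans (and_congr ?_ ?_)
    · rw [PDLModel.sat_bigAndUp M _ w n hn]
      refine forall_congr' fun j => forall_congr' fun h₁ => forall_congr' fun _ => ?_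
      simp only [PDLModel.Sat, PDLModel.rel_seqPrefFrom M step w j h₁]
      rfl
    · simp only [PDLModel.rel_seqPrefFrom M step w n hn]
      rfl
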